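/- N(1144) ≥ 8; that is, there exist 8 mutually orthogonal latin squares of order 1144 = 8 × 11 × 13. -/

import Mathlib

/-- A latin square of order `n`: an `n × n` array with entries from an `n`-element
symbol set such that every row and every column contains each symbol exactly once. -/
def IsLatinSquare {n : ℕ} (L : Fin n → Fin n → Fin n) : Prop :=
  (∀ i, Function.Bijective fun j => L i j) ∧ (∀ j, Function.Bijective fun i => L i j)

/-- Two latin squares of order `n` are orthogonal if the `n²` superimposed
ordered pairs of entries are all distinct. -/
def AreOrthogonal {n : ℕ} (L M : Fin n → Fin n → Fin n) : Prop :=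
  Function.Injective fun p : Fin n × Fin n => (L p.1 p.2, M p.1 p.2)

/-- There exist `r` mutually orthogonal latin squares (MOLS) of order `n`. -/
def HasMOLS (n r : ℕ) : Prop :=
  ∃ L : Fin r → Fin n → Fin n → Fin n,
    (∀ s, IsLatinSquare (L s)) ∧ ∀ s t : Fin r, s ≠ t → AreOrthogonal (L s) (L t)

/-- `molsNum n` is `N(n)`, the maximum size of a set of MOLS of order `n`. -/
noncomputable def molsNum (n : ℕ) : ℕ := sSup {r | HasMOLS n r}

/-- Base columns of a quasi-difference matrix over `ZMod 1027`, acted on by the group of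
`117`-torsion units (row `k` lists the ten entries of column `k`; the diagonal is empty). -/
def baseTab : List (List ℕ) :=
  [[0, 0, 573, 263, 383, 512, 751, 960, 516, 285],
   [383, 0, 0, 573, 263, 285, 512, 751, 960, 516],
   [263, 383, 0, 0, 573, 516, 285, 512, 751, 960],
   [573, 263, 383, 0, 0, 960, 516, 285, 512, 751],
   [0, 573, 263, 383, 0, 751, 960, 516, 285, 512],
   [512, 285, 516, 960, 751, 0, 383, 263, 573, 0],
   [751, 512, 285, 516, 960, 0, 0, 383, 263, 573],
   [960, 751, 512, 285, 516, 573, 0, 0, 383, 263],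
   [516, 960, 751, 512, 285, 263, 573, 0, 0, 383],
   [285, 516, 960, 751, 512, 383, 263, 573, 0, 0]]

/-- Entry of base column `k` in row `r`. -/
def baseC (k r : ℕ) : ℕ := (baseTab.getD k []).getD r 0

/-- The eight values of `d ^ 117` for units `d`. -/
def powVals : List ℕ := [1, 157, 317, 473, 554, 710, 870, 1026]

lemma check_vals : ∀ d < 1027, d % 13 ≠ 0 → d % 79 ≠ 0 → d ^ 117 % 1027 ∈ powVals := by
  decide +kernel

lemma check_base : ∀ i < 10, ∀ j < 10, i ≠ j → ∀ v ∈ powVals, ∃ k < 10, k ≠ i ∧ k ≠ j ∧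
    (baseC k i + 1027 - baseC k j) ^ 117 % 1027 = v := by
  decide +kernel

lemma check_base_le : ∀ i < 10, ∀ k < 10, baseC k i ≤ 1027 := by
  decide +kernel

lemma check_tors : ∀ x < 1027, x ^ 117 % 1027 = 1 →
    ∃ t < 117, (9 ^ (t / 3) * 22 ^ (t % 3)) % 1027 = x := by
  decide +kernel

/-- Ten pairwise surjective coordinates on `X × X`, i.e. an orthogonal array. -/
def HasOA (X : Type) : Prop :=
  ∃ f : Fin 10 → X × X → X, ∀ i j, i ≠ j → Function.Surjective fun b => (f i b, f j b)

lemma HasOA.of_blocks {X B : Type} [Fintype X] [Fintype B]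
    (hc : Fintype.card B = Fintype.card X * Fintype.card X)
    (f : Fin 10 → B → X) (hf : ∀ i j, i ≠ j → Function.Surjective fun b => (f i b, f j b)) :
    HasOA X := by
  have e : X × X ≃ B := Fintype.equivOfCardEq (by rw [Fintype.card_prod, hc])
  exact ⟨fun i p => f i (e p), fun i j h => (hf i j h).comp e.surjective⟩

lemma HasOA.congr {X Y : Type} (e : X ≃ Y) (h : HasOA X) : HasOA Y := by
  obtain ⟨f, hf⟩ := h
  refine ⟨fun i p => e (f i (e.symm p.1, e.symm p.2)), fun i j hij => ?_⟩
  rintro ⟨x, y⟩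
  obtain ⟨⟨a, b⟩, hab⟩ := hf i j hij (e.symm x, e.symm y)
  refine ⟨(e a, e b), ?_⟩
  simp only [Prod.mk.injEq] at hab
  simp [hab.1, hab.2]

lemma HasOA.prod {X Y : Type} (h : HasOA X) (h' : HasOA Y) : HasOA (X × Y) := by
  obtain ⟨f, hf⟩ := h
  obtain ⟨g, hg⟩ := h'
  refine ⟨fun i p => (f i (p.1.1, p.2.1), g i (p.1.2, p.2.2)), fun i j hij => ?_⟩
  rintro ⟨⟨x, y⟩, ⟨x', y'⟩⟩
  obtain ⟨⟨a, b⟩, hab⟩ := hf i j hij (x, x')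
  obtain ⟨⟨c, d⟩, hcd⟩ := hg i j hij (y, y')
  refine ⟨((a, c), (b, d)), ?_⟩
  simp only [Prod.mk.injEq] at hab hcd
  simp [hab.1, hab.2, hcd.1, hcd.2]

lemma hasOA_field (F : Type) [Field F] (e : Fin 9 → F) (he : Function.Injective e) :
    HasOA F := by
  refine ⟨fun i p => if h : i.1 < 9 then p.1 + e ⟨i.1, h⟩ * p.2 else p.2, fun i j hij => ?_⟩
  rintro ⟨x, y⟩
  by_cases hi : i.1 < 9 <;> by_cases hj : j.1 < 9
  · have hne : e ⟨i.1, hi⟩ - e ⟨j.1, hj⟩ ≠ 0 := by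
      rw [sub_ne_zero]
      intro h
      have := he h
      simp only [Fin.mk.injEq] at this
      exact hij (Fin.ext this)
    refine ⟨(x - e ⟨i.1, hi⟩ * ((x - y) / (e ⟨i.1, hi⟩ - e ⟨j.1, hj⟩)),
      (x - y) / (e ⟨i.1, hi⟩ - e ⟨j.1, hj⟩)), ?_⟩
    simp only [hi, hj, dite_true, Prod.mk.injEq]
    revert hne
    generalize e ⟨i.1, hi⟩ = a
    generalize e ⟨j.1, hj⟩ = b
    intro hne
    have key : (a - b) * ((x - y) / (a - b)) = x - y := mul_div_cancel₀ _ hne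
    constructor
    · ring
    · linear_combination -key
  · refine ⟨(x - e ⟨i.1, hi⟩ * y, y), ?_⟩
    simp [hi, hj]
  · refine ⟨(y - e ⟨j.1, hj⟩ * x, x), ?_⟩
    simp [hi, hj]
  · exact absurd (Fin.ext (by omega)) hij

lemma hasOA_fill : HasOA (GaloisField 3 2 × ZMod 13) := by
  have key : Function.Injective (fun i : Fin 9 => ((i.1 : ℕ) : ZMod 13)) := by decide
  have : Fact (Nat.Prime 3) := ⟨by norm_num⟩
  have : Fact (Nat.Prime 13) := ⟨by norm_num⟩
  refine HasOA.prod ?_ ?_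
  · have hc : Nat.card (GaloisField 3 2) = 9 := by
      rw [GaloisField.card 3 2 (by norm_num)]; norm_num
    have e := (Finite.equivFinOfCardEq hc).symm
    exact hasOA_field _ e e.injective
  · refine hasOA_field _ (fun i : Fin 9 => ((i.1 : ℕ) : ZMod 13)) key

/-- The `91` multipliers of the linear columns. -/
def linE (l : Fin 91) : ZMod 1027 :=
  if l.1 < 79 then ((13 * l.1 : ℕ) : ZMod 1027) else ((79 * (l.1 - 78) : ℕ) : ZMod 1027)

lemma linE_surj (x : ZMod 1027) (hx : ¬ IsUnit x) : ∃ l, linE l = x := by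
  have hlt : x.val < 1027 := ZMod.val_lt x
  have hxe : ((x.val : ℕ) : ZMod 1027) = x := ZMod.natCast_zmod_val x
  by_cases h1 : x.val % 13 = 0
  · refine ⟨⟨x.val / 13, by omega⟩, ?_⟩
    have : x.val / 13 < 79 := by omega
    simp only [linE, this, if_true]
    rw [Nat.mul_div_cancel' (Nat.dvd_of_mod_eq_zero h1), hxe]
  · by_cases h2 : x.val % 79 = 0
    · refine ⟨⟨x.val / 79 + 78, by omega⟩, ?_⟩
      have : ¬ (x.val / 79 + 78 < 79) := by omega
      simp only [linE, this, if_false, Nat.add_sub_cancel]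
      rw [Nat.mul_div_cancel' (Nat.dvd_of_mod_eq_zero h2), hxe]
    · exfalso
      apply hx
      rw [← hxe, ZMod.isUnit_iff_coprime]
      have hp : (1027 : ℕ) = 13 * 79 := by norm_num
      generalize x.val = m at h1 h2
      rw [hp]
      refine Nat.Coprime.mul_right ?_ ?_
      · exact ((Nat.Prime.coprime_iff_not_dvd (by norm_num)).2
          (fun h => h1 (Nat.mod_eq_zero_of_dvd h))).symm
      · exact ((Nat.Prime.coprime_iff_not_dvd (by norm_num)).2
          (fun h => h2 (Nat.mod_eq_zero_of_dvd h))).symm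

lemma not_isUnit_of_dvd (x : ZMod 1027) (h : x.val % 13 = 0 ∨ x.val % 79 = 0) :
    ¬ IsUnit x := by
  intro hu
  rw [← ZMod.natCast_zmod_val x, ZMod.isUnit_iff_coprime] at hu
  rcases h with h | h
  · have := Nat.dvd_gcd (Nat.dvd_of_mod_eq_zero h) (by norm_num : 13 ∣ 1027)
    rw [hu] at this
    omega
  · have := Nat.dvd_gcd (Nat.dvd_of_mod_eq_zero h) (by norm_num : 79 ∣ 1027)
    rw [hu] at this
    omega

/-- Parametrisation of the `117`-torsion units. -/
def tors (t : Fin 117) : ZMod 1027 := ((9 ^ (t.1 / 3) * 22 ^ (t.1 % 3) : ℕ) : ZMod 1027)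

lemma tors_surj (x : ZMod 1027) (hx : x ^ 117 = 1) : ∃ t, tors t = x := by
  have hlt : x.val < 1027 := ZMod.val_lt x
  have hxe : ((x.val : ℕ) : ZMod 1027) = x := ZMod.natCast_zmod_val x
  have h : x.val ^ 117 % 1027 = 1 := by
    have h0 : ((x.val ^ 117 : ℕ) : ZMod 1027) = ((1 : ℕ) : ZMod 1027) := by
      rw [Nat.cast_pow, hxe, hx, Nat.cast_one]
    rw [ZMod.natCast_eq_natCast_iff] at h0
    exact h0
  obtain ⟨t, ht, he⟩ := check_tors _ hlt h
  refine ⟨⟨t, ht⟩, ?_⟩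
  rw [tors, ← hxe, ZMod.natCast_eq_natCast_iff, Nat.ModEq, he, Nat.mod_eq_of_lt hlt]

lemma unit_cover (i j : Fin 10) (hij : i ≠ j) (d : ZMod 1027) (hd : IsUnit d) :
    ∃ k : Fin 10, k ≠ i ∧ k ≠ j ∧ ∃ t,
      ((baseC k.1 i.1 : ℕ) - (baseC k.1 j.1 : ℕ) : ZMod 1027) * tors t = d := by
  have hlt : d.val < 1027 := ZMod.val_lt d
  have hde : ((d.val : ℕ) : ZMod 1027) = d := ZMod.natCast_zmod_val d
  have hv := check_vals d.val hlt (fun h => not_isUnit_of_dvd d (Or.inl h) hd)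
    (fun h => not_isUnit_of_dvd d (Or.inr h) hd)
  obtain ⟨k, hk, hki, hkj, he⟩ := check_base i.1 i.2 j.1 j.2 (fun h => hij (Fin.ext h)) _ hv
  refine ⟨⟨k, hk⟩, fun h => hki (by rw [← h]), fun h => hkj (by rw [← h]), ?_⟩
  have hle := check_base_le j.1 j.2 k hk
  have hpow : ((baseC k i.1 : ℕ) - (baseC k j.1 : ℕ) : ZMod 1027) ^ 117 = d ^ 117 := by
    have h0 : (((baseC k i.1 + 1027 - baseC k j.1) ^ 117 : ℕ) : ZMod 1027)
        = ((d.val ^ 117 : ℕ) : ZMod 1027) := by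
      rw [ZMod.natCast_eq_natCast_iff]
      exact he
    rw [Nat.cast_pow, Nat.cast_pow, hde, Nat.cast_sub (by omega), Nat.cast_add,
      ZMod.natCast_self, add_zero] at h0
    exact h0
  generalize ((baseC k i.1 : ℕ) - (baseC k j.1 : ℕ) : ZMod 1027) = c at hpow
  have hc : IsUnit c := by
    have : IsUnit (c ^ 117) := by rw [hpow]; exact hd.pow 117
    exact (isUnit_pow_iff (by norm_num)).1 this
  obtain ⟨u, rfl⟩ := hc
  obtain ⟨t, ht⟩ := tors_surj (↑u⁻¹ * d) (by
    rw [mul_pow, ← hpow, ← mul_pow, Units.inv_mul, one_pow])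
  exact ⟨t, by rw [ht, Units.mul_inv_cancel_left]⟩

lemma isUnit_row_sub (i j : Fin 10) (hij : i ≠ j) :
    IsUnit (((i.1 : ℕ) : ZMod 1027) - ((j.1 : ℕ) : ZMod 1027)) := by
  have key : ∀ a < 10, ∀ b < a, IsUnit (((a : ℕ) : ZMod 1027) - ((b : ℕ) : ZMod 1027)) := by
    intro a ha b hb
    rw [← Nat.cast_sub hb.le, ZMod.isUnit_iff_coprime]
    have h1 : 0 < a - b := by omega
    have h2 : a - b < 10 := by omega
    generalize a - b = c at *
    interval_cases c <;> norm_num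
  rcases lt_or_gt_of_ne (fun h => hij (Fin.ext h) : i.1 ≠ j.1) with h | h
  · rw [← neg_sub]
    exact (key _ j.2 _ h).neg
  · exact key _ i.2 _ h

/-- The blocks of the big array. -/
lemma hasOA_big {J : Type} [Fintype J] (hJ : Fintype.card J = 117) (h : HasOA J) :
    HasOA (ZMod 1027 ⊕ J) := by
  obtain ⟨f0, hf0⟩ := h
  have eJ : J ≃ Fin 117 := Fintype.equivFinOfCardEq hJ
  refine HasOA.of_blocks
    (B := (Fin 91 × ZMod 1027) ⊕ ((Fin 10 × J × ZMod 1027) ⊕ (J × J))) ?_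
    (fun r b => match b with
      | Sum.inl (l, g) => Sum.inl (((r.1 : ℕ) : ZMod 1027) * linE l + g)
      | Sum.inr (Sum.inl (k, t, g)) =>
          if r = k then Sum.inr t else Sum.inl ((baseC k.1 r.1 : ZMod 1027) * tors (eJ t) + g)
      | Sum.inr (Sum.inr p) => Sum.inr (f0 r p)) ?_
  · simp only [Fintype.card_sum, Fintype.card_prod, Fintype.card_fin, ZMod.card, hJ]
  · intro i j hij
    rintro ⟨x | x, y | y⟩
    · by_cases hd : IsUnit (x - y)
      · obtain ⟨k, hki, hkj, t, ht⟩ := unit_cover i j hij _ hd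
        refine ⟨Sum.inr (Sum.inl (k, eJ.symm t, y - (baseC k.1 j.1 : ZMod 1027) * tors t)), ?_⟩
        simp only [hki.symm, hkj.symm, if_false, Equiv.apply_symm_apply, Prod.mk.injEq,
          Sum.inl.injEq]
        constructor
        · linear_combination ht
        · ring
      · obtain ⟨u, hu⟩ := isUnit_row_sub i j hij
        obtain ⟨l, hl⟩ := linE_surj (↑u⁻¹ * (x - y)) (by
          intro h
          exact hd ((Units.isUnit_units_mul _ _).1 h))
        have h1 : (((i.1 : ℕ) : ZMod 1027) - ((j.1 : ℕ) : ZMod 1027)) * linE l = x - y := by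
          rw [hl, ← hu, Units.mul_inv_cancel_left]
        refine ⟨Sum.inl (l, y - ((j.1 : ℕ) : ZMod 1027) * linE l), ?_⟩
        simp only [Prod.mk.injEq, Sum.inl.injEq]
        constructor
        · linear_combination h1
        · ring
    · refine ⟨Sum.inr (Sum.inl (j, y, x - (baseC j.1 i.1 : ZMod 1027) * tors (eJ y))), ?_⟩
      simp [hij]
    · refine ⟨Sum.inr (Sum.inl (i, x, y - (baseC i.1 j.1 : ZMod 1027) * tors (eJ x))), ?_⟩
      simp [hij.symm]
    · obtain ⟨p, hp⟩ := hf0 i j hij (x, y)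
      refine ⟨Sum.inr (Sum.inr p), ?_⟩
      simp only [Prod.mk.injEq] at hp
      simp [hp.1, hp.2]

lemma hasMOLS_of_hasOA {n : ℕ} (h : HasOA (Fin n)) : HasMOLS n 8 := by
  obtain ⟨f, hf⟩ := h
  have inj : ∀ i j, i ≠ j → ∀ p q, f i p = f i q → f j p = f j q → p = q := by
    intro i j hij p q h1 h2
    have := Finite.injective_iff_surjective.2 (hf i j hij)
    exact this (Prod.ext h1 h2)
  choose g hg using hf 0 1 (by decide)
  have g0 : ∀ p, f 0 (g p) = p.1 := fun p => congrArg Prod.fst (hg p)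
  have g1 : ∀ p, f 1 (g p) = p.2 := fun p => congrArg Prod.snd (hg p)
  have s0 : ∀ s : Fin 8, (0 : Fin 10) ≠ Fin.natAdd 2 s := by decide
  have s1 : ∀ s : Fin 8, (1 : Fin 10) ≠ Fin.natAdd 2 s := by decide
  refine ⟨fun s i j => f (Fin.natAdd 2 s) (g (i, j)), fun s => ⟨fun i => ?_, fun j => ?_⟩, ?_⟩
  · refine Finite.injective_iff_bijective.1 ?_
    intro a b hab
    have := inj 0 _ (s0 s) (g (i, a)) (g (i, b)) (by rw [g0, g0]) hab
    have := congrArg (f 1) this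
    rwa [g1, g1] at this
  · refine Finite.injective_iff_bijective.1 ?_
    intro a b hab
    have := inj 1 _ (s1 s) (g (a, j)) (g (b, j)) (by rw [g1, g1]) hab
    have := congrArg (f 0) this
    rwa [g0, g0] at this
  · intro s t hst p q hpq
    simp only [Prod.mk.injEq] at hpq
    have := inj _ _ (fun h => hst (Fin.natAdd_injective _ _ h)) _ _ hpq.1 hpq.2
    have h0 := congrArg (f 0) this
    have h1 := congrArg (f 1) this
    rw [g0, g0] at h0
    rw [g1, g1] at h1
    exact Prod.ext h0 h1

lemma bddAbove_mols {n : ℕ} (hn : 2 ≤ n) : BddAbove {r | HasMOLS n r} := by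
  refine ⟨Fintype.card (Fin n → Fin n → Fin n), ?_⟩
  rintro r ⟨L, -, hL⟩
  have hinj : Function.Injective L := by
    intro s t hst
    by_contra hne
    have ho := hL s t hne
    rw [← hst] at ho
    have hi : Function.Injective fun p : Fin n × Fin n => L s p.1 p.2 := by
      intro p q hpq
      exact ho (Prod.ext hpq hpq)
    have := Fintype.card_le_of_injective _ hi
    simp only [Fintype.card_prod, Fintype.card_fin] at this
    nlinarith
  have := Fintype.card_le_of_injective _ hinj
  rwa [Fintype.card_fin] at this

lemma hasOA_1144 : HasOA (Fin 1144) := by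
  have : Fact (Nat.Prime 3) := ⟨by norm_num⟩
  have hfin : Nat.card (GaloisField 3 2 × ZMod 13) = 117 := by
    rw [Nat.card_prod, GaloisField.card 3 2 (by norm_num), Nat.card_zmod]
    norm_num
  have e := Finite.equivFinOfCardEq hfin
  have h := hasOA_big (Fintype.card_fin 117) (hasOA_fill.congr e)
  refine h.congr (Fintype.equivFinOfCardEq ?_)
  simp only [Fintype.card_sum, ZMod.card, Fintype.card_fin]

theorem molsNum_1144 : 8 ≤ molsNum (8 * 11 * 13) := by
  have h : HasMOLS (8 * 11 * 13) 8 := hasMOLS_of_hasOA hasOA_1144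
  exact le_csSup (bddAbove_mols (by norm_num)) h
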